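/- arXiv:2603.10972 — 3 statements merged into one kernel-verified Lean document; each statement's English description precedes it below -/
import Mathlib

section
/- Let L be a Lie ring and let α, β, γ ∈ L satisfy ⁅⁅α,β⁆,γ⁆ = ⁅α,⁅β,γ⁆⁆. Then 2•⁅⁅⁅α,β⁆,γ⁆,β⁆ = ⁅⁅⁅α,β⁆,β⁆,γ⁆ + ⁅α,⁅⁅β,γ⁆,β⁆⁆ (the 'Hokkyo identity' for splitting nested commutators). -/
/-- **Hokkyo identity.**  In any Lie ring `L`, if the two ways of bracketing the triple
nested commutator of `α, β, γ` agree, i.e. `⁅⁅α,β⁆,γ⁆ = ⁅α,⁅β,γ⁆⁆`, then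
`2•⁅⁅⁅α,β⁆,γ⁆,β⁆ = ⁅⁅⁅α,β⁆,β⁆,γ⁆ + ⁅α,⁅⁅β,γ⁆,β⁆⁆`. -/
theorem hokkyo_identity {L : Type*} [LieRing L] (α β γ : L)
    (h : ⁅⁅α, β⁆, γ⁆ = ⁅α, ⁅β, γ⁆⁆) :
    2 • ⁅⁅⁅α, β⁆, γ⁆, β⁆ = ⁅⁅⁅α, β⁆, β⁆, γ⁆ + ⁅α, ⁅⁅β, γ⁆, β⁆⁆ := by
  have leibniz (x y : L) : ⁅⁅x, y⁆, β⁆ = ⁅⁅x, β⁆, y⁆ + ⁅x, ⁅y, β⁆⁆ := by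
    rw [leibniz_lie x y β, ← lie_skew y ⁅x, β⁆]
    abel
  calc 2 • ⁅⁅⁅α, β⁆, γ⁆, β⁆
      = ⁅⁅⁅α, β⁆, γ⁆, β⁆ + ⁅⁅α, ⁅β, γ⁆⁆, β⁆ := by rw [two_nsmul, h]
    _ = ⁅⁅⁅α, β⁆, β⁆, γ⁆ + ⁅α, ⁅⁅β, γ⁆, β⁆⁆ := by
      rw [leibniz ⁅α, β⁆ γ, leibniz α ⁅β, γ⁆, ← lie_skew γ β, lie_neg]
      abel
end

section
/- Let M, D ∈ Module.End ℂ (Polynomial ℂ) be the ℂ-linear operators of multiplication by X and of formal differentiation, respectively. For all natural numbers x, y, x', y': ⁅M^x ∘ D^y, M^{x'} ∘ D^{y'}⁆ = Σ_{z=1}^{min(x+x', y+y')} z!·(C(y,z)·C(x',z) − C(x,z)·C(y',z)) · M^{x+x'−z} ∘ D^{y+y'−z}, where C(n,z) denotes the binomial coefficient, the integer coefficient is regarded as a complex scalar, and ⁅A,B⁆ := A∘B − B∘A. -/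
noncomputable section

/-- Multiplication by `X` on `ℂ[X]` (the creation operator `b†`). -/
def M : Module.End ℂ (Polynomial ℂ) := LinearMap.mulLeft ℂ Polynomial.X

/-- Formal differentiation on `ℂ[X]` (the annihilation operator `b`). -/
def D : Module.End ℂ (Polynomial ℂ) := Polynomial.derivative

lemma M_pow_apply (n : ℕ) (p : Polynomial ℂ) : (M ^ n) p = Polynomial.X ^ n * p := by
  simp [M, LinearMap.pow_mulLeft]

lemma D_pow_apply (n : ℕ) (p : Polynomial ℂ) : (D ^ n) p = Polynomial.derivative^[n] p := by
  rw [D, Module.End.pow_apply]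

/-- Normal ordering of an antinormally ordered monomial. -/
lemma D_pow_mul_M_pow (m n : ℕ) :
    D ^ m * M ^ n = ∑ z ∈ Finset.range (m + 1),
      ((z.factorial : ℂ) * ((m.choose z : ℂ) * (n.choose z : ℂ))) •
        (M ^ (n - z) * D ^ (m - z)) := by
  refine LinearMap.ext fun p => ?_
  simp only [Module.End.mul_apply, LinearMap.sum_apply, LinearMap.smul_apply, M_pow_apply,
    D_pow_apply]
  rw [mul_comm, Polynomial.iterate_derivative_mul]
  refine Finset.sum_congr rfl fun z _ => ?_
  rw [Polynomial.iterate_derivative_X_pow_eq_smul, Nat.descFactorial_eq_factorial_mul_choose,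
    mul_smul_comm, ← Nat.cast_smul_eq_nsmul ℂ, smul_smul,
    mul_comm (Polynomial.derivative^[m - z] p)]
  congr 1
  push_cast
  ring

/-- Normal ordering of a product of normally ordered monomials; the sum may run over any finite
set containing every index with a nonzero coefficient. -/
lemma normal_ordered_mul (x y x' y' : ℕ) (s : Finset ℕ) (hs : ∀ z, z ≤ y → z ≤ x' → z ∈ s) :
    M ^ x * D ^ y * (M ^ x' * D ^ y') = ∑ z ∈ s,
      ((z.factorial : ℂ) * ((y.choose z : ℂ) * (x'.choose z : ℂ))) •
        (M ^ (x + x' - z) * D ^ (y + y' - z)) := by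
  rw [mul_assoc, ← mul_assoc (D ^ y), D_pow_mul_M_pow, Finset.sum_mul, Finset.mul_sum]
  refine Finset.sum_congr_of_eq_on_inter ?_ ?_ ?_
  · intro z hz hzs
    have hzx : x' < z := by
      by_contra! h
      exact hzs (hs z (Nat.lt_succ_iff.mp (Finset.mem_range.mp hz)) h)
    simp [Nat.choose_eq_zero_of_lt hzx]
  · intro z _ hz
    have hzy : y < z := by simpa using hz
    simp [Nat.choose_eq_zero_of_lt hzy]
  · intro z hz _
    have hzy : z ≤ y := Nat.lt_succ_iff.mp (Finset.mem_range.mp hz)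
    rcases lt_or_ge x' z with h | h
    · simp [Nat.choose_eq_zero_of_lt h]
    · rw [smul_mul_assoc, mul_smul_comm, Nat.add_sub_assoc h, Nat.sub_add_comm hzy, pow_add,
        pow_add]
      simp only [mul_assoc]

/-- Commutator formula for normal-ordered monomials in a single bosonic mode:
`⁅M^x D^y, M^{x'} D^{y'}⁆ = Σ_{z=1}^{min(x+x',y+y')} z!·(C(y,z)C(x',z) − C(x,z)C(y',z))
 · M^{x+x'−z} D^{y+y'−z}`. -/
theorem commutator_normal_ordered (x y x' y' : ℕ) :
    ⁅M ^ x * D ^ y, M ^ x' * D ^ y'⁆ =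
      ∑ z ∈ Finset.Icc 1 (min (x + x') (y + y')),
        ((z.factorial : ℂ) *
            ((y.choose z : ℂ) * (x'.choose z : ℂ) - (x.choose z : ℂ) * (y'.choose z : ℂ))) •
          (M ^ (x + x' - z) * D ^ (y + y' - z)) := by
  rw [Ring.lie_def,
    normal_ordered_mul x y x' y' (Finset.Icc 0 (min (x + x') (y + y')))
      (fun z h h' => by simp only [Finset.mem_Icc]; omega),
    normal_ordered_mul x' y' x y (Finset.Icc 0 (min (x + x') (y + y')))
      (fun z h h' => by simp only [Finset.mem_Icc]; omega),
    ← Finset.sum_sub_distrib]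
  symm
  refine Finset.sum_subset_zero_on_sdiff (Finset.Icc_subset_Icc_left zero_le_one) ?_ ?_
  · intro z hz
    have hz0 : z = 0 := by
      simp only [Finset.mem_sdiff, Finset.mem_Icc] at hz
      omega
    simp [hz0, add_comm x' x, add_comm y' y]
  · intro z _
    rw [add_comm x' x, add_comm y' y]
    refine eq_sub_of_add_eq ?_
    rw [← add_smul]
    congr 1
    ring

end
end

section
/- Let R := MvPolynomial ℤ ℂ, and for each integer m let a†_m ∈ Module.End ℂ R be multiplication by the variable X_m and a_m := pderiv m. For integers i < j define h(i,j) := a†_i ∘ a_j + (−1)^{j−i+1} · a†_j ∘ a_i. Then for all integers i < j < k: ⁅h(i,j), h(j,k)⁆ = h(i,k). Consequently the operator h_{1:k} = b†₁b_k + (−1)^k b₁b†_k of the bosonic chain equals the iterated commutator h(1,2) ∘ h(2,3) ∘ ⋯ ∘ h(k−1,k) of nearest-neighbor hopping terms, where x ∘ y := ⁅x,y⁆. -/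
open MvPolynomial

noncomputable section

/-- Creation operator at site `m` of the infinite bosonic chain:
multiplication by the variable `X m` on `MvPolynomial ℤ ℂ`. -/
def ad (m : ℤ) : Module.End ℂ (MvPolynomial ℤ ℂ) := LinearMap.mulLeft ℂ (X m)

/-- Annihilation operator at site `m`: the partial derivative `pderiv m`. -/
def an (m : ℤ) : Module.End ℂ (MvPolynomial ℤ ℂ) := (pderiv m).toLinearMap

/-- The hopping-type operator `h(i,j) = a†_i a_j + (−1)^{j−i+1} a†_j a_i`. -/
def hop (i j : ℤ) : Module.End ℂ (MvPolynomial ℤ ℂ) :=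
  ad i * an j + ((-1 : ℂ) ^ (j - i + 1)) • (ad j * an i)

/-- The iterated commutator `h(1,2) ∘ h(2,3) ∘ ⋯ ∘ h(n+2-1, n+2)`
(left-nested; `hopIter n` is the candidate for `h(1, n+2)`). -/
def hopIter : ℕ → Module.End ℂ (MvPolynomial ℤ ℂ)
  | 0 => hop 1 2
  | n + 1 => ⁅hopIter n, hop ((n : ℤ) + 2) ((n : ℤ) + 3)⁆

/-- The quadratic operator `X i * ∂ⱼ` is a derivation, hence so is `hop i j`. -/
def hopDerivation (i j : ℤ) : Derivation ℂ (MvPolynomial ℤ ℂ) (MvPolynomial ℤ ℂ) :=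
  (X i : MvPolynomial ℤ ℂ) • pderiv j +
    ((-1 : ℂ) ^ (j - i + 1)) • (X j : MvPolynomial ℤ ℂ) • pderiv i

theorem hopDerivation_apply (i j : ℤ) (p : MvPolynomial ℤ ℂ) :
    hopDerivation i j p =
      X i * pderiv j p + ((-1 : ℂ) ^ (j - i + 1)) • (X j * pderiv i p) :=
  rfl

theorem coe_hopDerivation (i j : ℤ) :
    (hopDerivation i j : Module.End ℂ (MvPolynomial ℤ ℂ)) = hop i j :=
  rfl

theorem lie_hopDerivation {i j k : ℤ} (hij : i ≠ j) (hjk : j ≠ k) (hik : i ≠ k) :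
    ⁅hopDerivation i j, hopDerivation j k⁆ = hopDerivation i k := by
  have hsign : (-1 : ℂ) ^ (k - i + 1) = -((-1) ^ (j - i + 1) * (-1) ^ (k - j + 1)) := by
    rw [← zpow_add₀ (by norm_num), show j - i + 1 + (k - j + 1) = k - i + 1 + 1 by ring,
      zpow_add_one₀ (by norm_num) (k - i + 1)]
    ring
  refine derivation_ext fun m => ?_
  rw [Derivation.commutator_apply]
  simp only [hopDerivation_apply, hsign]
  by_cases hi : m = i
  · subst hi
    simp [pderiv_X, hij, hjk, hik, smul_smul, mul_comm]
  by_cases hj : m = j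
  · subst hj
    simp [pderiv_X, hij, hij.symm, hjk, hjk.symm, hik, hik.symm]
  by_cases hk : m = k
  · subst hk
    simp [pderiv_X, hij.symm, hjk.symm, hik.symm]
  simp [pderiv_X, hi, hj, hk]

theorem lie_hop {i j k : ℤ} (hij : i ≠ j) (hjk : j ≠ k) (hik : i ≠ k) :
    ⁅hop i j, hop j k⁆ = hop i k := by
  simp only [← coe_hopDerivation, ← lie_hopDerivation hij hjk hik,
    Derivation.commutator_coe_linear_map]

/-- For all integers `i < j < k`, `⁅h(i,j), h(j,k)⁆ = h(i,k)`; consequently the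
operator `h_{1:k}` equals the iterated commutator of nearest-neighbor hopping terms. -/
theorem hop_bracket :
    (∀ i j k : ℤ, i < j → j < k → ⁅hop i j, hop j k⁆ = hop i k) ∧
    (∀ n : ℕ, hopIter n = hop 1 ((n : ℤ) + 2)) := by
  refine ⟨fun i j k hij hjk => lie_hop hij.ne hjk.ne (hij.trans hjk).ne, fun n => ?_⟩
  induction n with
  | zero => simp [hopIter]
  | succ n ih =>
    rw [hopIter, ih, lie_hop (by omega) (by omega) (by omega)]
    congr 1

end
end
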